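/- There exists a universal constant c > 0 such that for every N ≥ 1 and every κ ∈ (0, 0.9) the following holds, where the sin model on {0,…,N} is the family of uniform probability measures U_k on the cells 𝔄(k) of the partition induced by the estimator E built from the grid p(a) = sin²(a·N^{−1/2}), a = 1,…,⌊(π/2)N^{1/2}⌋−1 (E(k) is the largest grid point ≤ k/N, or p(1) if none), and where a p-function w.r.t. a family of probability measures on {0,…,N} is a [0,1]-valued function f such that each measure of {f ≤ ε} is at most ε for all ε > 0. (a) For every p-function f w.r.t. the sin model, the function k ↦ min(1, c·κ^{−1}·f(k)^{1−κ}) is a p-function w.r.t. the family of binomial measures bin_p, p ∈ [0,1]. (b) For every p-function f w.r.t. the family of binomial measures, the function k ↦ min(1, κ^{−1}·(c·f(k))^{1−κ}) is a p-function w.r.t. the sin model. -/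

import Mathlib

open MeasureTheory
open scoped ENNReal

/-- `N* = ⌊(π/2)·√N⌋`. -/
noncomputable def Nstar (N : ℕ) : ℕ := ⌊(Real.pi / 2) * Real.sqrt N⌋₊

/-- The grid point `p(a) = sin²(a·N^{-1/2})`. -/
noncomputable def gridpt (N a : ℕ) : ℝ := Real.sin ((a : ℝ) / Real.sqrt N) ^ 2

/-- The estimator `E : {0,…,N} → [0,1]`: `E(k)` is the largest grid point
`p(a)`, `a ∈ {1,…,N*-1}`, with `p(a) ≤ k/N` (the grid is increasing on this
range, so this is attained at the largest such index `a`); if there is no such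
grid point, `E(k) = p(1)`. -/
noncomputable def Est (N k : ℕ) : ℝ :=
  letI : DecidablePred fun a : ℕ => gridpt N a ≤ (k : ℝ) / N := Classical.decPred _
  let S := (Finset.Icc 1 (Nstar N - 1)).filter fun a => gridpt N a ≤ (k : ℝ) / N
  if hS : S.Nonempty then gridpt N (S.max' hS) else gridpt N 1

/-- The cell `𝔄(k) = E⁻¹(E(k))` of the partition of `{0,…,N}` induced by `E`. -/
noncomputable def cell (N k : ℕ) : Finset ℕ :=
  letI : DecidablePred fun j : ℕ => Est N j = Est N k := Classical.decPred _
  (Finset.range (N + 1)).filter fun j => Est N j = Est N k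

/-- The uniform probability measure `U_k` on the cell `𝔄(k)`. -/
noncomputable def unif (N k : ℕ) : Measure ℕ :=
  ((cell N k).card : ℝ≥0∞)⁻¹ • ∑ j ∈ cell N k, Measure.dirac j

/-- The binomial measure `bin_p` on `ℕ` (supported on `{0,…,N}`):
`bin_p({k}) = binom(N,k) p^k (1-p)^{N-k}`. -/
noncomputable def binMeasure (N : ℕ) (p : ℝ≥0∞) : Measure ℕ :=
  ∑ k ∈ Finset.range (N + 1),
    ((N.choose k : ℝ≥0∞) * p ^ k * (1 - p) ^ (N - k)) • Measure.dirac k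

/-- The mass at `j` of the binomial law with real parameter `p`. -/
noncomputable def binomialMass (N : ℕ) (p : ℝ) (j : ℕ) : ℝ :=
  N.choose j * p ^ j * (1 - p) ^ (N - j)

/-- The variance-stabilizing transformation of the binomial family. -/
noncomputable def angle (x : ℝ) : ℝ := Real.arcsin √x

theorem sin_angle {x : ℝ} (h1 : x ≤ 1) : Real.sin (angle x) = √x :=
  Real.sin_arcsin (by linarith [Real.sqrt_nonneg x]) (Real.sqrt_le_one.mpr h1)

theorem cos_angle {x : ℝ} (h0 : 0 ≤ x) : Real.cos (angle x) = √(1 - x) := by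
  rw [angle, Real.cos_arcsin, Real.sq_sqrt h0]

theorem angle_nonneg (x : ℝ) : 0 ≤ angle x := Real.arcsin_nonneg.mpr (Real.sqrt_nonneg x)

theorem angle_le (x : ℝ) : angle x ≤ Real.pi / 2 := Real.arcsin_le_pi_div_two _

theorem binomialMass_nonneg {N : ℕ} {p : ℝ} (h0 : 0 ≤ p) (h1 : p ≤ 1) (j : ℕ) :
    0 ≤ binomialMass N p j := by
  have : 0 ≤ 1 - p := by linarith
  unfold binomialMass; positivity

theorem sum_binomialMass (N : ℕ) (p : ℝ) :
    ∑ j ∈ Finset.range (N + 1), binomialMass N p j = 1 := by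
  have := add_pow p (1 - p) N
  simp only [add_sub_cancel, one_pow] at this
  rw [this]
  exact Finset.sum_congr rfl fun j _ => by unfold binomialMass; ring

theorem binomialMass_le_one {N : ℕ} {p : ℝ} (h0 : 0 ≤ p) (h1 : p ≤ 1) {j : ℕ} (hj : j ≤ N) :
    binomialMass N p j ≤ 1 := by
  rw [← sum_binomialMass N p]
  exact Finset.single_le_sum (fun i _ => binomialMass_nonneg h0 h1 i)
    (Finset.mem_range.mpr (by omega))

theorem factorial_le_stirling {n : ℕ} (hn : 1 ≤ n) :
    (n.factorial : ℝ) ≤ Real.exp 1 * √n * (n / Real.exp 1) ^ n := by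
  obtain ⟨m, rfl⟩ : ∃ m, n = m + 1 := ⟨n - 1, by omega⟩
  have h := Stirling.stirlingSeq'_antitone (Nat.zero_le m)
  simp only [Function.comp, Nat.succ_eq_add_one, zero_add, Stirling.stirlingSeq_one] at h
  rw [Stirling.stirlingSeq, div_le_iff₀ (by positivity)] at h
  refine h.trans (le_of_eq ?_)
  have h2 : (√2 : ℝ) ≠ 0 := by positivity
  rw [Real.sqrt_mul (by norm_num)]
  field_simp

theorem stirling_le_factorial (n : ℕ) :
    5 / 2 * √n * (n / Real.exp 1) ^ n ≤ (n.factorial : ℝ) := by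
  refine le_trans ?_ (Stirling.le_factorial_stirling n)
  rw [Real.sqrt_mul (by positivity)]
  gcongr
  apply Real.le_sqrt_of_sq_le
  nlinarith [Real.pi_gt_d2]

theorem pow_mul_pow_le_exp {a b : ℝ} (ha : 0 ≤ a) (hb : 0 ≤ b) (m n : ℕ) :
    a ^ m * b ^ n ≤ Real.exp (m * (a - 1) + n * (b - 1)) := by
  rw [Real.exp_add, Real.exp_nat_mul, Real.exp_nat_mul]
  gcongr
  · linarith [Real.add_one_le_exp (a - 1)]
  · linarith [Real.add_one_le_exp (b - 1)]

/-- Comparison with the binomial law whose mean is the observation: lower bound. -/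
theorem binomialMass_mean_le {N j : ℕ} (hN : 1 ≤ N) (hj : j ≤ N) {p : ℝ} (h0 : 0 < p)
    (h1 : p < 1) :
    binomialMass N (j / N) j ≤
      binomialMass N p j * Real.exp (N * (j / N - p) ^ 2 / (p * (1 - p))) := by
  have hN' : (0 : ℝ) < N := by exact_mod_cast hN
  have hq : 0 < 1 - p := by linarith
  have hx1 : (j / N : ℝ) ≤ 1 := (div_le_one hN').mpr (by exact_mod_cast hj)
  have hx0 : (0 : ℝ) ≤ j / N := by positivity
  have key := pow_mul_pow_le_exp (a := (j / N : ℝ) / p) (b := (1 - j / N : ℝ) / (1 - p))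
    (by positivity) (div_nonneg (by linarith) hq.le) j (N - j)
  have he : (j : ℝ) * ((j / N : ℝ) / p - 1) + ((N - j : ℕ) : ℝ) * ((1 - j / N : ℝ) / (1 - p) - 1)
      = N * (j / N - p) ^ 2 / (p * (1 - p)) := by
    rw [Nat.cast_sub hj]; field_simp
    ring
  rw [he, div_pow (j / N : ℝ) p, div_pow (1 - j / N : ℝ), div_mul_div_comm,
    div_le_iff₀ (by positivity)] at key
  unfold binomialMass
  calc _ = (N.choose j : ℝ) * ((j / N : ℝ) ^ j * (1 - j / N : ℝ) ^ (N - j)) := by ring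
    _ ≤ _ := mul_le_mul_of_nonneg_left key (by positivity)
    _ = _ := by ring

theorem cos_angle_sub {x p : ℝ} (hx0 : 0 ≤ x) (hx1 : x ≤ 1) (hp0 : 0 ≤ p) (hp1 : p ≤ 1) :
    Real.cos (angle p - angle x) = √p * √x + √(1 - p) * √(1 - x) := by
  rw [Real.cos_sub, sin_angle hx1, sin_angle hp1, cos_angle hx0, cos_angle hp0]; ring

theorem nat_mul_sqrt_div {N j : ℕ} (hN : 1 ≤ N) (p : ℝ) (hp : 0 ≤ p) :
    (j : ℝ) * √(p / (j / N)) = N * (√p * √(j / N)) := by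
  rcases Nat.eq_zero_or_pos j with rfl | hj
  · simp
  · have hN' : (0 : ℝ) < N := by exact_mod_cast hN
    have hj' : (0 : ℝ) < j := by exact_mod_cast hj
    rw [Real.sqrt_div hp]
    have h : √(j / N : ℝ) ≠ 0 := by positivity
    have h2 := Real.mul_self_sqrt (show (0 : ℝ) ≤ j / N by positivity)
    field_simp
    rw [show (√(j / N : ℝ)) ^ 2 = j / N by rw [sq, h2]]
    field_simp

theorem pow_eq_pow_mul_sqrt_div_pow {N j : ℕ} (hN : 1 ≤ N) (p : ℝ) (hp : 0 ≤ p) :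
    p ^ j = (j / N : ℝ) ^ j * (√(p / (j / N)) ^ j) ^ 2 := by
  rcases Nat.eq_zero_or_pos j with rfl | hj
  · simp
  · have hN' : (0 : ℝ) < N := by exact_mod_cast hN
    have hj' : (0 : ℝ) < j := by exact_mod_cast hj
    rw [← pow_mul, mul_comm j 2, pow_mul, Real.sq_sqrt (by positivity), ← mul_pow]
    congr 1
    field_simp

/-- Comparison with the binomial law whose mean is the observation: upper bound. -/
theorem binomialMass_le_mean {N j : ℕ} (hN : 1 ≤ N) (hj : j ≤ N) {p : ℝ} (h0 : 0 ≤ p)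
    (h1 : p ≤ 1) :
    binomialMass N p j ≤ binomialMass N (j / N) j *
      Real.exp (-(2 * N * (1 - Real.cos (angle p - angle (j / N))))) := by
  have hN' : (0 : ℝ) < N := by exact_mod_cast hN
  have hq : 0 ≤ 1 - p := by linarith
  have hx1 : (j / N : ℝ) ≤ 1 := (div_le_one hN').mpr (by exact_mod_cast hj)
  have hx0 : (0 : ℝ) ≤ j / N := by positivity
  have hy : (1 - j / N : ℝ) = ((N - j : ℕ) : ℝ) / N := by
    rw [Nat.cast_sub hj]; field_simp
  have hy0 : 0 ≤ (1 - j / N : ℝ) := by linarith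
  have key := pow_mul_pow_le_exp (Real.sqrt_nonneg (p / (j / N)))
    (Real.sqrt_nonneg ((1 - p) / (1 - j / N))) j (N - j)
  have he : (j : ℝ) * (√(p / (j / N)) - 1) +
      ((N - j : ℕ) : ℝ) * (√((1 - p) / (1 - j / N)) - 1)
      = -(N * (1 - Real.cos (angle p - angle (j / N)))) := by
    rw [cos_angle_sub hx0 hx1 h0 h1, mul_sub, mul_sub, nat_mul_sqrt_div hN p h0, hy,
      nat_mul_sqrt_div hN (1 - p) hq, Nat.cast_sub hj]
    ring
  rw [he] at key
  have key2 := pow_le_pow_left₀ (by positivity) key 2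
  rw [← Real.exp_nat_mul] at key2
  have e1 := pow_eq_pow_mul_sqrt_div_pow (j := j) hN p h0
  have e2 := pow_eq_pow_mul_sqrt_div_pow (j := N - j) hN (1 - p) hq
  rw [← hy] at e2
  unfold binomialMass
  calc _ = (N.choose j : ℝ) * (j / N : ℝ) ^ j * (1 - j / N : ℝ) ^ (N - j) *
        (√(p / (j / N)) ^ j * √((1 - p) / (1 - j / N)) ^ (N - j)) ^ 2 := by
          rw [e1, e2]; ring
    _ ≤ _ := by
      gcongr
      refine key2.trans (le_of_eq ?_)
      congr 1; push_cast; ring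

theorem binomialMass_mean_bounds {N j : ℕ} (hN : 1 ≤ N) (hj : j ≤ N) :
    1 / 3 ≤ binomialMass N (j / N) j * (1 + √(j * (N - j) / N)) ∧
      binomialMass N (j / N) j * (1 + √(j * (N - j) / N)) ≤ 2 := by
  have hN' : (0 : ℝ) < N := by exact_mod_cast hN
  have hx1 : (j / N : ℝ) ≤ 1 := (div_le_one hN').mpr (by exact_mod_cast hj)
  have hx0 : (0 : ℝ) ≤ j / N := by positivity
  rcases Nat.eq_zero_or_pos j with rfl | hj0
  · simp [binomialMass]; norm_num
  rcases hj.eq_or_lt with rfl | hjN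
  · simp [binomialMass, hN'.ne']; norm_num
  have hB0 := binomialMass_nonneg (N := N) hx0 hx1 j
  have hB1 := binomialMass_le_one hx0 hx1 hj
  have hj' : (0 : ℝ) < j := by exact_mod_cast hj0
  have hm' : (0 : ℝ) < ((N - j : ℕ) : ℝ) := by exact_mod_cast (by omega : 0 < N - j)
  set m := N - j with hm
  have hNm : (N : ℝ) - j = m := by rw [hm, Nat.cast_sub hj]
  have hy : (1 - j / N : ℝ) = m / N := by rw [← hNm]; field_simp
  have hσ : √(j * (N - j) / N : ℝ) = √j * √m / √N := by
    rw [hNm, Real.sqrt_div (by positivity), Real.sqrt_mul (by positivity)]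
  have he := Real.exp_pos 1
  have hpow : (N / Real.exp 1 : ℝ) ^ N = (N / Real.exp 1 : ℝ) ^ j * (N / Real.exp 1 : ℝ) ^ m := by
    rw [← pow_add]; congr 1; omega
  have hB : binomialMass N (j / N) j * (j.factorial * m.factorial) * (N / Real.exp 1 : ℝ) ^ N =
      N.factorial * ((j / Real.exp 1) ^ j * (m / Real.exp 1) ^ m) := by
    have hc : (N.choose j : ℝ) * j.factorial * m.factorial = N.factorial := by
      exact_mod_cast Nat.choose_mul_factorial_mul_factorial hj
    rw [binomialMass, hy, ← hm, ← hc, hpow]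
    simp only [div_pow]
    field_simp
  set B := binomialMass N (j / N) j
  set P := (j / Real.exp 1 : ℝ) ^ j * (m / Real.exp 1) ^ m
  set Q := (N / Real.exp 1 : ℝ) ^ N
  have hP : 0 < P := by positivity
  have hQ : 0 < Q := by positivity
  have uj := factorial_le_stirling hj0
  have um := factorial_le_stirling (n := m) (by omega)
  have uN := factorial_le_stirling hN
  have lj := stirling_le_factorial j
  have lm := stirling_le_factorial m
  have lN := stirling_le_factorial N
  have hsN : 0 < √(N : ℝ) := by positivity
  have hsj : 0 < √(j : ℝ) := by positivity
  have hsm : 0 < √(m : ℝ) := by positivity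
  have he3 : Real.exp 1 < 2.7182818286 := Real.exp_one_lt_d9
  rw [hσ]
  have low : 1 / 3 ≤ B * (√j * √m / √N) := by
    have h1 : 5 / 2 * √N * Q * P ≤ B * ((Real.exp 1 * √j) * (Real.exp 1 * √m) * P) * Q := by
      calc 5 / 2 * √N * Q * P ≤ N.factorial * P := by gcongr
        _ = B * (j.factorial * m.factorial) * Q := hB.symm
        _ ≤ B * ((Real.exp 1 * √j * (j / Real.exp 1) ^ j) *
              (Real.exp 1 * √m * (m / Real.exp 1) ^ m)) * Q := by gcongr
        _ = _ := by ring
    have h2 : 5 / 2 * √N ≤ B * (√j * √m) * (Real.exp 1) ^ 2 := by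
      refine le_of_mul_le_mul_right ?_ (mul_pos hP hQ)
      linarith
    have h3 : (Real.exp 1) ^ 2 ≤ 15 / 2 := by nlinarith
    rw [← mul_div_assoc, le_div_iff₀ hsN]
    have h4 : B * (√j * √m) * (Real.exp 1) ^ 2 ≤ B * (√j * √m) * (15 / 2) := by gcongr
    linarith
  have up : B * (√j * √m / √N) ≤ 1 := by
    have h1 : B * ((5 / 2 * √j) * (5 / 2 * √m) * P) * Q ≤ Real.exp 1 * √N * Q * P := by
      calc _ = B * ((5 / 2 * √j * (j / Real.exp 1) ^ j) *
              (5 / 2 * √m * (m / Real.exp 1) ^ m)) * Q := by ring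
        _ ≤ B * (j.factorial * m.factorial) * Q := by gcongr
        _ = N.factorial * P := hB
        _ ≤ _ := by gcongr
    have h2 : B * (√j * √m) * (25 / 4) ≤ Real.exp 1 * √N := by
      refine le_of_mul_le_mul_right ?_ (mul_pos hP hQ)
      linarith
    rw [← mul_div_assoc, div_le_iff₀ hsN]
    nlinarith
  constructor <;> linarith

theorem sum_inv_shift_le (s : ℝ) (L : ℕ) :
    ∑ a ∈ Finset.range L, 1 / ((1 + |(a : ℝ) - s|) * (2 + |(a : ℝ) - s|)) ≤ 2 := by
  let g : ℝ → ℝ := fun x => x / (1 + |x|)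
  have hg : ∀ x, |g x| ≤ 1 := fun x => by
    rw [abs_div, abs_of_pos (by positivity : 0 < 1 + |x|), div_le_one (by positivity)]
    linarith
  have step : ∀ x : ℝ, 1 / ((1 + |x|) * (2 + |x|)) ≤ g (x + 1) - g x := fun x => by
    simp only [g]
    rcases le_total 0 x with hx | hx
    · rw [abs_of_nonneg hx, abs_of_nonneg (by linarith : 0 ≤ x + 1),
        div_sub_div _ _ (by linarith) (by linarith), div_le_div_iff₀ (by positivity) (by positivity)]
      nlinarith
    · rw [abs_of_nonpos hx]
      rcases le_total 0 (x + 1) with hx1 | hx1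
      · rw [abs_of_nonneg hx1, div_sub_div _ _ (by linarith) (by linarith),
          div_le_div_iff₀ (mul_pos (by linarith) (by linarith))
            (mul_pos (by linarith) (by linarith))]
        have : 1 ≤ (x + 1) * (1 + -x) - (1 + (x + 1)) * x := by nlinarith
        have h2 : (1 + (x + 1)) * (1 + -x) ≤ (1 + -x) * (2 + -x) := by nlinarith
        have h3 : 0 ≤ (1 + -x) * (2 + -x) := mul_nonneg (by linarith) (by linarith)
        nlinarith
      · rw [abs_of_nonpos hx1, div_sub_div _ _ (by linarith) (by linarith),
          div_le_div_iff₀ (mul_pos (by linarith) (by linarith))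
            (mul_pos (by linarith) (by linarith))]
        nlinarith [mul_nonneg (neg_nonneg.mpr hx) (neg_nonneg.mpr hx1)]
  calc _ ≤ ∑ a ∈ Finset.range L, (g ((a + 1 : ℕ) - s) - g ((a : ℕ) - s)) := by
        refine Finset.sum_le_sum fun a _ => ?_
        have := step ((a : ℝ) - s)
        rwa [show (a : ℝ) - s + 1 = ((a + 1 : ℕ) : ℝ) - s by push_cast; ring] at this
    _ = g ((L : ℕ) - s) - g ((0 : ℕ) - s) := Finset.sum_range_sub (fun a : ℕ => g ((a : ℝ) - s)) L
    _ ≤ 2 := by linarith [(abs_le.mp (hg ((L : ℕ) - s))).2, (abs_le.mp (hg ((0 : ℕ) - s))).1]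

theorem gridpt_le_iff {N a : ℕ} (hN : 1 ≤ N) (ha : (a : ℝ) ≤ Real.pi / 2 * √N) {x : ℝ}
    (h1 : x ≤ 1) (h0 : 0 ≤ x) : gridpt N a ≤ x ↔ (a : ℝ) ≤ √N * angle x := by
  have hs : 0 < √(N : ℝ) := by positivity
  have h2 : (a : ℝ) / √N ≤ Real.pi / 2 := (div_le_iff₀ hs).mpr ha
  have h3 : 0 ≤ (a : ℝ) / √N := by positivity
  have h4 : 0 ≤ Real.sin (a / √N) :=
    Real.sin_nonneg_of_nonneg_of_le_pi h3 (by linarith [Real.pi_pos])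
  rw [gridpt, ← div_le_iff₀' hs, angle,
    Real.le_arcsin_iff_sin_le ⟨by linarith [Real.pi_pos], h2⟩
      ⟨by linarith [Real.sqrt_nonneg x], Real.sqrt_le_one.mpr h1⟩, Real.le_sqrt h4 h0]

theorem angle_gridpt {N a : ℕ} (hN : 1 ≤ N) (ha : (a : ℝ) ≤ Real.pi / 2 * √N) :
    √N * angle (gridpt N a) = a := by
  have hs : 0 < √(N : ℝ) := by positivity
  have h2 : (a : ℝ) / √N ≤ Real.pi / 2 := (div_le_iff₀ hs).mpr ha
  have h3 : 0 ≤ (a : ℝ) / √N := by positivity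
  have h4 : 0 ≤ Real.sin (a / √N) :=
    Real.sin_nonneg_of_nonneg_of_le_pi h3 (by linarith [Real.pi_pos])
  rw [angle, gridpt, Real.sqrt_sq h4, Real.arcsin_sin (by linarith [Real.pi_pos]) h2]
  field_simp

theorem Nstar_le (N : ℕ) : (Nstar N : ℝ) ≤ Real.pi / 2 * √N := Nat.floor_le (by positivity)

theorem lt_Nstar (N : ℕ) : Real.pi / 2 * √N < Nstar N + 1 := Nat.lt_floor_add_one _

theorem frac_mem {N k : ℕ} (hN : 1 ≤ N) (hk : k ≤ N) : (0 : ℝ) ≤ k / N ∧ (k / N : ℝ) ≤ 1 :=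
  ⟨by positivity, (div_le_one (by exact_mod_cast hN)).mpr (by exact_mod_cast hk)⟩

theorem gridpt_le_frac_iff {N k a : ℕ} (hN : 1 ≤ N) (hk : k ≤ N) (ha : a ≤ Nstar N) :
    gridpt N a ≤ (k : ℝ) / N ↔ (a : ℝ) ≤ √N * angle (k / N) :=
  gridpt_le_iff hN (le_trans (by exact_mod_cast ha) (Nstar_le N)) (frac_mem hN hk).2
    (frac_mem hN hk).1

open Classical in
theorem Est_eq_dite (N k : ℕ) : Est N k =
    if hS : ((Finset.Icc 1 (Nstar N - 1)).filter fun a => gridpt N a ≤ (k : ℝ) / N).Nonempty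
    then gridpt N (Finset.max' _ hS) else gridpt N 1 := by
  unfold Est; congr!

/-- `k` is estimated by the grid point whose angle is within distance `2 / √N`. -/
theorem exists_Est_eq_gridpt {N k : ℕ} (hN : 1 ≤ N) (hk : k ≤ N) :
    ∃ a : ℕ, 1 ≤ a ∧ (a : ℝ) + 1 / 2 ≤ Real.pi / 2 * √N ∧ (a ≤ Nstar N - 1 ∨ N = 1) ∧
      Est N k = gridpt N a ∧ |√N * angle (k / N) - a| ≤ 2 := by
  have hs : 0 < √(N : ℝ) := by positivity
  have hs1 : 1 ≤ √(N : ℝ) := Real.one_le_sqrt.mpr (by exact_mod_cast hN)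
  have hpi := Real.pi_gt_d2
  have hpi' := Real.pi_lt_d2
  have ht0 : 0 ≤ √N * angle (k / N) := mul_nonneg hs.le (angle_nonneg _)
  have ht1 : √N * angle (k / N) ≤ Real.pi / 2 * √N := by
    rw [mul_comm]; exact mul_le_mul_of_nonneg_right (angle_le _) hs.le
  have hNs := Nstar_le N
  have hNs' := lt_Nstar N
  classical
  have hEst := Est_eq_dite N k
  split_ifs at hEst with hS
  · set S := (Finset.Icc 1 (Nstar N - 1)).filter fun a => gridpt N a ≤ (k : ℝ) / N
    have hmem : S.max' hS ∈ S := Finset.max'_mem S hS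
    have hmax : ∀ b ∈ S, b ≤ S.max' hS := fun b hb => Finset.le_max' S b hb
    generalize S.max' hS = a at *
    obtain ⟨haI, hale⟩ := Finset.mem_filter.mp hmem
    obtain ⟨ha1, haM⟩ := Finset.mem_Icc.mp haI
    have haM' : (a : ℝ) + 1 ≤ Nstar N := by exact_mod_cast (by omega : a + 1 ≤ Nstar N)
    rw [gridpt_le_frac_iff hN hk (by omega)] at hale
    refine ⟨a, ha1, by linarith, Or.inl haM, hEst, ?_⟩
    rw [abs_of_nonneg (by linarith)]
    by_cases hlast : a + 1 ≤ Nstar N - 1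
    · by_contra! hlt
      have : a + 1 ∈ S := by
        refine Finset.mem_filter.mpr ⟨Finset.mem_Icc.mpr ⟨by omega, hlast⟩, ?_⟩
        rw [gridpt_le_frac_iff hN hk (by omega)]
        push_cast; linarith
      have := hmax _ this
      omega
    · have : (Nstar N : ℝ) = a + 1 := by exact_mod_cast (by omega : Nstar N = a + 1)
      linarith
  · by_cases hM : 1 ≤ Nstar N - 1
    · have hM' : (2 : ℝ) ≤ Nstar N := by exact_mod_cast (by omega : 2 ≤ Nstar N)
      refine ⟨1, le_rfl, by push_cast; linarith, Or.inl hM, hEst, ?_⟩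
      have hlt : ¬ gridpt N 1 ≤ (k : ℝ) / N := fun h =>
        hS ⟨1, Finset.mem_filter.mpr ⟨Finset.mem_Icc.mpr ⟨le_rfl, hM⟩, h⟩⟩
      rw [gridpt_le_frac_iff hN hk (by omega)] at hlt
      push_cast at hlt ⊢
      rw [abs_le]; constructor <;> linarith
    · have hM' : (Nstar N : ℝ) ≤ 1 := by exact_mod_cast (by omega : Nstar N ≤ 1)
      have hN1 : N = 1 := by
        by_contra hne
        have h2 : (2 : ℝ) ≤ N := by exact_mod_cast (by omega : 2 ≤ N)
        have h4 : (1.4 : ℝ) ≤ √N := Real.le_sqrt_of_sq_le (by norm_num; linarith)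
        nlinarith
      refine ⟨1, le_rfl, by push_cast; nlinarith, Or.inr hN1, hEst, ?_⟩
      push_cast
      rw [abs_le]; constructor <;> linarith

theorem Est_eq_gridpt {N j a : ℕ} (hN : 1 ≤ N) (hj : j ≤ N) (ha1 : 1 ≤ a)
    (haM : a ≤ Nstar N - 1) (h1 : gridpt N a ≤ (j : ℝ) / N)
    (h2 : (j : ℝ) / N < gridpt N (a + 1)) : Est N j = gridpt N a := by
  classical
  have hEst := Est_eq_dite N j
  set S := (Finset.Icc 1 (Nstar N - 1)).filter fun a => gridpt N a ≤ (j : ℝ) / N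
  have haS : a ∈ S := Finset.mem_filter.mpr ⟨Finset.mem_Icc.mpr ⟨ha1, haM⟩, h1⟩
  have hS : S.Nonempty := ⟨a, haS⟩
  rw [dif_pos hS] at hEst
  have hmem : S.max' hS ∈ S := Finset.max'_mem S hS
  have hle : a ≤ S.max' hS := Finset.le_max' S a haS
  generalize S.max' hS = b at *
  obtain ⟨hbI, hble⟩ := Finset.mem_filter.mp hmem
  obtain ⟨hb1, hbM⟩ := Finset.mem_Icc.mp hbI
  rw [hEst]
  congr 1
  by_contra hne
  rw [gridpt_le_frac_iff hN hj (by omega)] at hble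
  rw [← not_le, gridpt_le_frac_iff hN hj (by omega)] at h2
  have : ((a + 1 : ℕ) : ℝ) ≤ b := by exact_mod_cast (by omega : a + 1 ≤ b)
  linarith

theorem mem_cell {N k j : ℕ} : j ∈ cell N k ↔ j ≤ N ∧ Est N j = Est N k := by
  simp [cell]

theorem self_mem_cell {N k : ℕ} (hk : k ≤ N) : k ∈ cell N k := mem_cell.mpr ⟨hk, rfl⟩

/-- Twice the standard deviation of the binomial law at the grid point with index `a`. -/
noncomputable def spread (N a : ℕ) : ℝ := √N * Real.sin (2 * (a / √N))

theorem half_le_spread {N a : ℕ} (hN : 1 ≤ N) (ha1 : 1 ≤ a)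
    (ha : (a : ℝ) + 1 / 2 ≤ Real.pi / 2 * √N) : 1 / 2 ≤ spread N a := by
  have hs : 0 < √(N : ℝ) := by positivity
  have hpi := Real.pi_pos
  have hpi' := Real.pi_lt_four
  have ha1' : (1 : ℝ) ≤ a := by exact_mod_cast ha1
  have key : ∀ y : ℝ, 1 / √N ≤ y → y ≤ Real.pi / 2 → 1 / 2 ≤ √N * Real.sin y := by
    intro y hy hy'
    have h0 : 0 ≤ y := le_trans (by positivity) hy
    have h1 := Real.mul_le_sin h0 hy'
    have h2 : 1 / 2 ≤ 2 / Real.pi := by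
      rw [div_le_div_iff₀ (by norm_num) hpi]; linarith
    rw [div_le_iff₀' hs] at hy
    calc (1 : ℝ) / 2 ≤ 2 / Real.pi * 1 := by linarith
      _ ≤ 2 / Real.pi * (√N * y) := by gcongr
      _ = √N * (2 / Real.pi * y) := by ring
      _ ≤ _ := by gcongr
  unfold spread
  rcases le_total (2 * (a / √N)) (Real.pi / 2) with h | h
  · refine key _ ?_ h
    rw [mul_div_assoc', div_le_div_iff_of_pos_right hs]; linarith
  · rw [← Real.sin_pi_sub]
    refine key _ ?_ (by linarith)
    have : Real.pi - 2 * (a / √N) = (Real.pi * √N - 2 * a) / √N := by field_simp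
    rw [this, div_le_div_iff_of_pos_right hs]
    linarith

theorem sin_sq_sub_sin_sq (x y : ℝ) :
    Real.sin x ^ 2 - Real.sin y ^ 2 = Real.sin (x - y) * Real.sin (x + y) := by
  rw [Real.sin_sub, Real.sin_add]
  linear_combination -Real.sin x ^ 2 * Real.sin_sq_add_cos_sq y +
    Real.sin y ^ 2 * Real.sin_sq_add_cos_sq x

theorem sqrt_var_eq {N j : ℕ} (hN : 1 ≤ N) (hj : j ≤ N) :
    2 * √(j * (N - j) / N : ℝ) = √N * Real.sin (2 * angle (j / N)) := by
  have hN' : (0 : ℝ) < N := by exact_mod_cast hN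
  obtain ⟨h0, h1⟩ := frac_mem hN hj
  rw [Real.sin_two_mul, sin_angle h1, cos_angle h0,
    show (j * (N - j) / N : ℝ) = N * (j / N * (1 - j / N)) by field_simp,
    Real.sqrt_mul hN'.le, Real.sqrt_mul h0]
  ring

theorem abs_var_sub_spread {N j a : ℕ} (hN : 1 ≤ N) (hj : j ≤ N)
    (h : |√N * angle (j / N) - a| ≤ 2) : |2 * √(j * (N - j) / N : ℝ) - spread N a| ≤ 4 := by
  have hs : 0 < √(N : ℝ) := by positivity
  rw [sqrt_var_eq hN hj, spread, ← mul_sub, abs_mul, abs_of_pos hs]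
  calc _ ≤ √N * |2 * angle (j / N) - 2 * (a / √N)| := by
        exact mul_le_mul_of_nonneg_left (Real.abs_sin_sub_sin_le _ _) hs.le
    _ = 2 * |√N * angle (j / N) - a| := by
        rw [← abs_of_pos hs, ← abs_mul, abs_of_pos hs, ← abs_of_pos (zero_lt_two' ℝ), ← abs_mul,
          abs_of_pos (zero_lt_two' ℝ)]
        congr 1; field_simp
    _ ≤ 4 := by linarith

theorem abs_sub_mean_le {N j a : ℕ} (hN : 1 ≤ N) (hj : j ≤ N) (hpos : 0 ≤ spread N a)
    (h : |√N * angle (j / N) - a| ≤ 2) : |(j : ℝ) - N * gridpt N a| ≤ 2 * spread N a + 4 := by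
  have hs : 0 < √(N : ℝ) := by positivity
  have hN' : (0 : ℝ) < N := by exact_mod_cast hN
  obtain ⟨h0, h1⟩ := frac_mem hN hj
  have hss : √(N : ℝ) * √N = N := Real.mul_self_sqrt hN'.le
  set θ := angle (j / N)
  set φ := (a : ℝ) / √N with hφ
  have hd : √N * |θ - φ| ≤ 2 := by
    rw [← abs_of_pos hs, ← abs_mul]
    rwa [mul_sub, hφ, mul_div_cancel₀ _ hs.ne']
  have e : (j : ℝ) - N * gridpt N a = (√N * Real.sin (θ - φ)) * (√N * Real.sin (θ + φ)) := by
    rw [mul_mul_mul_comm, hss, ← sin_sq_sub_sin_sq, gridpt, sin_angle h1, Real.sq_sqrt h0,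
      mul_sub, mul_div_cancel₀ _ hN'.ne']
  have b1 : |√N * Real.sin (θ - φ)| ≤ 2 := by
    rw [abs_mul, abs_of_pos hs]
    refine le_trans ?_ hd
    refine mul_le_mul_of_nonneg_left ?_ hs.le
    simpa using Real.abs_sin_sub_sin_le (θ - φ) 0
  have b2 : |√N * Real.sin (θ + φ)| ≤ spread N a + 2 := by
    have h3 : |√N * Real.sin (θ + φ) - spread N a| ≤ 2 := by
      rw [spread, ← mul_sub, abs_mul, abs_of_pos hs]
      refine le_trans ?_ hd
      refine mul_le_mul_of_nonneg_left ?_ hs.le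
      refine (Real.abs_sin_sub_sin_le _ _).trans (le_of_eq ?_)
      congr 1; ring
    rw [abs_le] at h3 ⊢
    constructor <;> linarith
  rw [e, abs_mul]
  calc _ ≤ 2 * (spread N a + 2) := by gcongr
    _ = _ := by ring

theorem card_le_of_abs_sub_le {C : Finset ℕ} {c D : ℝ} (hD : 0 ≤ D)
    (h : ∀ j ∈ C, |(j : ℝ) - c| ≤ D) : (C.card : ℝ) ≤ 2 * D + 1 := by
  rcases C.eq_empty_or_nonempty with rfl | hC
  · simp; linarith
  have hsub : C ⊆ Finset.Icc (C.min' hC) (C.max' hC) := fun j hj =>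
    Finset.mem_Icc.mpr ⟨C.min'_le j hj, C.le_max' j hj⟩
  have hle : C.min' hC ≤ C.max' hC := C.min'_le_max' hC
  have h1 := abs_le.mp (h _ (C.min'_mem hC))
  have h2 := abs_le.mp (h _ (C.max'_mem hC))
  have hcard := Finset.card_le_card hsub
  rw [Nat.card_Icc] at hcard
  have : (C.card : ℝ) + C.min' hC ≤ C.max' hC + 1 := by exact_mod_cast (by omega)
  linarith

theorem dist_of_mem_cell {N k j a : ℕ} (hN : 1 ≤ N) (hka : Est N k = gridpt N a)
    (ha : (a : ℝ) + 1 / 2 ≤ Real.pi / 2 * √N) (hj : j ∈ cell N k) :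
    |√N * angle (j / N) - a| ≤ 2 := by
  obtain ⟨hjN, hjE⟩ := mem_cell.mp hj
  obtain ⟨b, -, hb, -, hEb, hd⟩ := exists_Est_eq_gridpt hN hjN
  have h1 := angle_gridpt hN (a := a) (by linarith)
  have h2 := angle_gridpt hN (a := b) (by linarith)
  rw [← hEb, hjE, hka, h1] at h2
  rwa [h2]

theorem card_cell_le {N k a : ℕ} (hN : 1 ≤ N) (ha1 : 1 ≤ a)
    (ha : (a : ℝ) + 1 / 2 ≤ Real.pi / 2 * √N) (hka : Est N k = gridpt N a) :
    ((cell N k).card : ℝ) ≤ 22 * spread N a := by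
  have hsp := half_le_spread hN ha1 ha
  have := card_le_of_abs_sub_le (C := cell N k) (c := N * gridpt N a)
    (D := 2 * spread N a + 4) (by linarith) fun j hj =>
      abs_sub_mean_le hN (mem_cell.mp hj).1 (by linarith) (dist_of_mem_cell hN hka ha hj)
  linarith

theorem spread_le_card_cell {N k a : ℕ} (hN : 1 ≤ N) (hk : k ≤ N) (ha1 : 1 ≤ a)
    (ha : (a : ℝ) + 1 / 2 ≤ Real.pi / 2 * √N) (haM : a ≤ Nstar N - 1 ∨ N = 1)
    (hka : Est N k = gridpt N a) :
    spread N a ≤ 6 * (cell N k).card := by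
  have hcard : (1 : ℝ) ≤ (cell N k).card := by
    exact_mod_cast Finset.card_pos.mpr ⟨k, self_mem_cell hk⟩
  have hs : 0 < √(N : ℝ) := by positivity
  have hN' : (0 : ℝ) < N := by exact_mod_cast hN
  rcases haM with haM | rfl
  swap
  · have : spread 1 a ≤ 1 := by simpa [spread] using Real.sin_le_one _
    linarith
  have hss : √(N : ℝ) * √N = N := Real.mul_self_sqrt hN'.le
  have hsub : Finset.Ico ⌈N * gridpt N a⌉₊ ⌈N * gridpt N (a + 1)⌉₊ ⊆ cell N k := by
    intro j hj
    obtain ⟨h1, h2⟩ := Finset.mem_Ico.mp hj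
    rw [Nat.ceil_le] at h1
    rw [Nat.lt_ceil] at h2
    have hle : gridpt N (a + 1) ≤ 1 := Real.sin_sq_le_one _
    have hjN : (j : ℝ) ≤ N := by nlinarith
    have hjN' : j ≤ N := by exact_mod_cast hjN
    refine mem_cell.mpr ⟨hjN', ?_⟩
    rw [hka]
    refine Est_eq_gridpt hN hjN' ha1 haM ?_ ?_
    · rw [le_div_iff₀ hN']; linarith
    · rw [div_lt_iff₀ hN']; linarith
  have hc := Finset.card_le_card hsub
  rw [Nat.card_Ico] at hc
  have hc' : (⌈N * gridpt N (a + 1)⌉₊ : ℝ) ≤ (cell N k).card + ⌈N * gridpt N a⌉₊ := by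
    exact_mod_cast (by omega)
  have l1 := Nat.le_ceil (N * gridpt N (a + 1))
  have l2 := Nat.ceil_lt_add_one (show 0 ≤ N * gridpt N a by unfold gridpt; positivity)
  have hdiff : N * gridpt N (a + 1) - N * gridpt N a =
      (√N * Real.sin (1 / √N)) * (√N * Real.sin ((2 * a + 1) / √N)) := by
    rw [mul_mul_mul_comm, hss, ← mul_sub, gridpt, gridpt, sin_sq_sub_sin_sq]
    push_cast
    congr 3 <;> · field_simp; ring
  have hpi := Real.pi_pos
  have hpi4 := Real.pi_lt_four
  have hs1 : 1 ≤ √(N : ℝ) := Real.one_le_sqrt.mpr (by exact_mod_cast hN)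
  have f1 : 1 / 2 ≤ √N * Real.sin (1 / √N) := by
    have h1 : 1 / √(N : ℝ) ≤ 1 := (div_le_one hs).mpr hs1
    have := Real.mul_le_sin (x := 1 / √(N : ℝ)) (by positivity) (by linarith [Real.pi_gt_three])
    have h2 : 1 / 2 ≤ 2 / Real.pi := by
      rw [div_le_div_iff₀ (by norm_num) hpi]; linarith
    calc (1 : ℝ) / 2 ≤ 2 / Real.pi := h2
      _ = √N * (2 / Real.pi * (1 / √N)) := by field_simp
      _ ≤ _ := by gcongr
  have f2 : spread N a - 1 ≤ √N * Real.sin ((2 * a + 1) / √N) := by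
    have h3 : |spread N a - √N * Real.sin ((2 * a + 1) / √N)| ≤ 1 := by
      rw [spread, ← mul_sub, abs_mul, abs_of_pos hs]
      calc _ ≤ √N * |2 * (a / √N) - (2 * a + 1) / √N| := by
            exact mul_le_mul_of_nonneg_left (Real.abs_sin_sub_sin_le _ _) hs.le
        _ = √N * |-(1 / √N)| := by congr 2; field_simp; ring
        _ = 1 := by rw [abs_neg, abs_of_pos (by positivity)]; field_simp
    linarith [(abs_le.mp h3).2]
  have f3 : 0 ≤ √N * Real.sin ((2 * a + 1) / √N) := by
    refine mul_nonneg hs.le (Real.sin_nonneg_of_nonneg_of_le_pi (by positivity) ?_)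
    rw [div_le_iff₀ hs]; linarith
  have f4 : 1 / 2 * (√N * Real.sin ((2 * a + 1) / √N)) ≤
      (√N * Real.sin (1 / √N)) * (√N * Real.sin ((2 * a + 1) / √N)) := by gcongr
  linarith

theorem exp_neg_le_inv_shift {x y : ℝ} (h : |x| ≤ |y| + 2) :
    Real.exp (-(4 / Real.pi ^ 2 * y ^ 2)) ≤ 64 * (1 / ((1 + |x|) * (2 + |x|))) := by
  have hpi := Real.pi_pos
  have hz : y ^ 2 / 4 ≤ 4 / Real.pi ^ 2 * y ^ 2 := by
    rw [div_mul_eq_mul_div, div_le_div_iff₀ (by norm_num) (by positivity)]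
    have : Real.pi ^ 2 ≤ 16 := by nlinarith [Real.pi_lt_four]
    nlinarith [sq_nonneg y]
  have hx := abs_nonneg x
  have hy := abs_nonneg y
  have hyy := sq_abs y
  rw [Real.exp_neg, mul_one_div, ← one_div, div_le_div_iff₀ (Real.exp_pos _) (by positivity)]
  have h1 := Real.add_one_le_exp (4 / Real.pi ^ 2 * y ^ 2)
  have h2 : (1 + |x|) * (2 + |x|) ≤ (3 + |y|) * (4 + |y|) :=
    mul_le_mul (by linarith) (by linarith) (by linarith) (by linarith)
  nlinarith [sq_nonneg (|y| - 1)]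

/-- The masses of a binomial law on a cell, in units of the inverse size of the cell, decay with
the distance of the angles. -/
theorem card_cell_mul_binomialMass_le {N k j a : ℕ} {p : ℝ} (hN : 1 ≤ N) (ha1 : 1 ≤ a)
    (ha : (a : ℝ) + 1 / 2 ≤ Real.pi / 2 * √N) (hka : Est N k = gridpt N a) (hj : j ∈ cell N k)
    (h0 : 0 ≤ p) (h1 : p ≤ 1) :
    (cell N k).card * binomialMass N p j ≤
      11264 * (1 / ((1 + |(a : ℝ) - √N * angle p|) * (2 + |(a : ℝ) - √N * angle p|))) := by
  have hN' : (0 : ℝ) < N := by exact_mod_cast hN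
  have hjN := (mem_cell.mp hj).1
  obtain ⟨x0, x1⟩ := frac_mem hN hjN
  have hd := dist_of_mem_cell hN hka ha hj
  have hcard := card_cell_le hN ha1 ha hka
  have hvar := abs_le.mp (abs_var_sub_spread hN hjN hd)
  have hup := (binomialMass_mean_bounds hN hjN).2
  have hB0 := binomialMass_nonneg (N := N) x0 x1 j
  have htilt := binomialMass_le_mean hN hjN h0 h1
  have hcos := Real.cos_le_one_sub_mul_cos_sq (x := angle p - angle (j / N))
    (abs_le.mpr ⟨by linarith [angle_nonneg p, angle_le (j / N), Real.pi_pos],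
      by linarith [angle_nonneg (j / N), angle_le p, Real.pi_pos]⟩)
  have hexp : Real.exp (-(2 * N * (1 - Real.cos (angle p - angle (j / N))))) ≤
      64 * (1 / ((1 + |(a : ℝ) - √N * angle p|) * (2 + |(a : ℝ) - √N * angle p|))) := by
    refine le_trans ?_ (exp_neg_le_inv_shift (y := √N * angle p - √N * angle (j / N)) ?_)
    · rw [Real.exp_le_exp, ← mul_sub, mul_pow, Real.sq_sqrt hN'.le, neg_le_neg_iff]
      have := mul_le_mul_of_nonneg_left hcos hN'.le
      have e : 4 / Real.pi ^ 2 * (N * (angle p - angle (j / N)) ^ 2) =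
          2 * (N * (2 / Real.pi ^ 2 * (angle p - angle (j / N)) ^ 2)) := by ring
      rw [e]
      linarith
    · have := abs_sub_le (a : ℝ) (√N * angle (j / N)) (√N * angle p)
      rw [abs_sub_comm (a : ℝ) (√N * angle (j / N)),
        abs_sub_comm (√N * angle (j / N)) (√N * angle p)] at this
      linarith
  set E := Real.exp (-(2 * N * (1 - Real.cos (angle p - angle (j / N)))))
  have hE : 0 < E := Real.exp_pos _
  set B := binomialMass N (j / N) j
  calc _ ≤ (88 * (1 + √(j * (N - j) / N : ℝ))) * (B * E) := by
        gcongr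
        · exact binomialMass_nonneg h0 h1 j
        · linarith [Real.sqrt_nonneg (j * (N - j) / N : ℝ)]
    _ = 88 * (B * (1 + √(j * (N - j) / N : ℝ))) * E := by ring
    _ ≤ 88 * 2 * (64 * _) := by gcongr
    _ = _ := by ring

theorem one_le_card_cell_mul_binomialMass {N k j a : ℕ} (hN : 1 ≤ N) (hk : k ≤ N) (ha1 : 1 ≤ a)
    (ha : (a : ℝ) + 1 / 2 ≤ Real.pi / 2 * √N) (haM : a ≤ Nstar N - 1 ∨ N = 1)
    (hka : Est N k = gridpt N a) (hj : j ∈ cell N k) :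
    1 ≤ 117 * Real.exp 400 * ((cell N k).card * binomialMass N (gridpt N a) j) := by
  have hN' : (0 : ℝ) < N := by exact_mod_cast hN
  have hjN := (mem_cell.mp hj).1
  obtain ⟨x0, x1⟩ := frac_mem hN hjN
  have hd := dist_of_mem_cell hN hka ha hj
  have hsp := half_le_spread hN ha1 ha
  have hcard := spread_le_card_cell hN hk ha1 ha haM hka
  have hvar := abs_le.mp (abs_var_sub_spread hN hjN hd)
  have hlow := (binomialMass_mean_bounds hN hjN).1
  have hmean := abs_sub_mean_le hN hjN (by linarith) hd
  have hsq : spread N a ^ 2 = 4 * N * (gridpt N a * (1 - gridpt N a)) := by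
    rw [spread, gridpt, Real.sin_two_mul, ← Real.cos_sq', mul_pow, Real.sq_sqrt hN'.le]
    ring
  have hpq : 0 < gridpt N a * (1 - gridpt N a) := by
    have : 0 < spread N a ^ 2 := by positivity
    rw [hsq] at this
    exact pos_of_mul_pos_right this (by positivity)
  have hp0 : 0 ≤ gridpt N a := sq_nonneg _
  have hp0' : 0 < gridpt N a := lt_of_le_of_ne hp0 fun h => by rw [← h] at hpq; simp at hpq
  have hp1 : gridpt N a < 1 := by
    have := pos_of_mul_pos_right hpq hp0
    linarith
  have htilt := binomialMass_mean_le hN hjN hp0' hp1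
  have hexp : N * (j / N - gridpt N a) ^ 2 / (gridpt N a * (1 - gridpt N a)) ≤ 400 := by
    rw [div_le_iff₀ hpq]
    have e : N * (N * (j / N - gridpt N a) ^ 2) = ((j : ℝ) - N * gridpt N a) ^ 2 := by
      field_simp
    have h10 : ((j : ℝ) - N * gridpt N a) ^ 2 ≤ (10 * spread N a) ^ 2 :=
      sq_le_sq' (by linarith [(abs_le.mp hmean).1]) (by linarith [(abs_le.mp hmean).2])
    refine le_of_mul_le_mul_left ?_ hN'
    rw [e]
    refine h10.trans (le_of_eq ?_)
    rw [mul_pow, hsq]; ring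
  have hb0 := binomialMass_nonneg (N := N) hp0 hp1.le j
  have hσ : 1 + √(j * (N - j) / N : ℝ) ≤ 39 * (cell N k).card := by linarith
  have : 1 / 3 ≤ (binomialMass N (gridpt N a) j * Real.exp 400) * (39 * (cell N k).card) :=
    hlow.trans (by
      gcongr
      refine htilt.trans ?_
      gcongr)
  linarith

theorem binMeasure_apply {N : ℕ} {p : ℝ≥0∞} (hp : p ≤ 1) (A : Set ℕ) [DecidablePred (· ∈ A)] :
    binMeasure N p A =
      ENNReal.ofReal (∑ j ∈ (Finset.range (N + 1)).filter (· ∈ A), binomialMass N p.toReal j) := by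
  have hpt : p ≠ ⊤ := ne_top_of_le_ne_top ENNReal.one_ne_top hp
  have h1 : p.toReal ≤ 1 := ENNReal.toReal_le_of_le_ofReal zero_le_one (by simpa using hp)
  have h0 : 0 ≤ p.toReal := ENNReal.toReal_nonneg
  have hq : (1 - p) = ENNReal.ofReal (1 - p.toReal) := by
    rw [ENNReal.ofReal_sub _ h0, ENNReal.ofReal_one, ENNReal.ofReal_toReal hpt]
  rw [ENNReal.ofReal_sum_of_nonneg fun j _ => binomialMass_nonneg h0 h1 j, Finset.sum_filter,
    binMeasure, Measure.coe_finsetSum, Finset.sum_apply]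
  refine Finset.sum_congr rfl fun j _ => ?_
  rw [Measure.smul_apply, Measure.dirac_apply, smul_eq_mul]
  by_cases hj : j ∈ A
  · rw [Set.indicator_of_mem hj, if_pos hj, Pi.one_apply, mul_one, binomialMass,
      ENNReal.ofReal_mul (by positivity), ENNReal.ofReal_mul (by positivity),
      ENNReal.ofReal_pow h0, ENNReal.ofReal_pow (by linarith), ← hq, ENNReal.ofReal_toReal hpt,
      ENNReal.ofReal_natCast]
  · rw [Set.indicator_of_notMem hj, if_neg hj, mul_zero]

theorem unif_apply {N k : ℕ} (hk : k ≤ N) (A : Set ℕ) [DecidablePred (· ∈ A)] :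
    unif N k A = ENNReal.ofReal (((cell N k).filter (· ∈ A)).card / (cell N k).card) := by
  have hc : 0 < (cell N k).card := Finset.card_pos.mpr ⟨k, self_mem_cell hk⟩
  rw [ENNReal.ofReal_div_of_pos (by exact_mod_cast hc), ENNReal.ofReal_natCast,
    ENNReal.ofReal_natCast, unif, Measure.smul_apply, Measure.coe_finsetSum, Finset.sum_apply,
    smul_eq_mul, mul_comm, ← div_eq_mul_inv, Finset.card_filter]
  congr 1
  push_cast
  refine Finset.sum_congr rfl fun j _ => ?_
  rw [Measure.dirac_apply, Set.indicator_apply]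
  rfl

theorem binMeasure_le_one {N : ℕ} {p : ℝ≥0∞} (hp : p ≤ 1) (A : Set ℕ) :
    binMeasure N p A ≤ 1 := by
  classical
  refine (measure_mono (Set.subset_univ A)).trans ?_
  rw [binMeasure_apply hp]
  simp [sum_binomialMass]

theorem unif_le_one {N k : ℕ} (hk : k ≤ N) (A : Set ℕ) : unif N k A ≤ 1 := by
  classical
  rw [unif_apply hk, ENNReal.ofReal_le_one]
  exact div_le_one_of_le₀ (by exact_mod_cast Finset.card_filter_le _ _) (by positivity)

/-- Uniform laws on the cells are dominated by binomial laws. -/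
theorem exists_unif_le_binMeasure {N k : ℕ} (hN : 1 ≤ N) (hk : k ≤ N) :
    ∃ p ≤ 1, ∀ A : Set ℕ,
      unif N k A ≤ ENNReal.ofReal (117 * Real.exp 400) * binMeasure N p A := by
  classical
  obtain ⟨a, ha1, ha, haM, hka, -⟩ := exists_Est_eq_gridpt hN hk
  have hp0 : 0 ≤ gridpt N a := sq_nonneg _
  have hp1 : gridpt N a ≤ 1 := Real.sin_sq_le_one _
  have hp : ENNReal.ofReal (gridpt N a) ≤ 1 := ENNReal.ofReal_le_one.mpr hp1
  refine ⟨ENNReal.ofReal (gridpt N a), hp, fun A => ?_⟩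
  rw [unif_apply hk, binMeasure_apply hp, ENNReal.toReal_ofReal hp0,
    ← ENNReal.ofReal_mul (by positivity)]
  refine ENNReal.ofReal_le_ofReal ?_
  have hc : (0 : ℝ) < (cell N k).card := by
    exact_mod_cast Finset.card_pos.mpr ⟨k, self_mem_cell hk⟩
  rw [div_le_iff₀ hc]
  calc (((cell N k).filter (· ∈ A)).card : ℝ)
      = ∑ j ∈ (cell N k).filter (· ∈ A), 1 := by simp
    _ ≤ ∑ j ∈ (cell N k).filter (· ∈ A), 117 * Real.exp 400 *
          ((cell N k).card * binomialMass N (gridpt N a) j) :=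
        Finset.sum_le_sum fun j hj => one_le_card_cell_mul_binomialMass hN hk ha1 ha haM hka
          (Finset.mem_filter.mp hj).1
    _ = 117 * Real.exp 400 * (∑ j ∈ (cell N k).filter (· ∈ A), binomialMass N (gridpt N a) j) *
          (cell N k).card := by rw [← Finset.mul_sum, ← Finset.mul_sum]; ring
    _ ≤ _ := by
      refine mul_le_mul_of_nonneg_right (mul_le_mul_of_nonneg_left ?_ (by positivity)) hc.le
      refine Finset.sum_le_sum_of_subset_of_nonneg (fun j hj => ?_)
        fun j _ _ => binomialMass_nonneg hp0 hp1 j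
      obtain ⟨h1, h2⟩ := Finset.mem_filter.mp hj
      exact Finset.mem_filter.mpr
        ⟨Finset.mem_range.mpr (Nat.lt_succ_of_le (mem_cell.mp h1).1), h2⟩

/-- A set that is small for all uniform laws on the cells is small for all binomial laws. -/
theorem binMeasure_le_of_unif_le {N : ℕ} (hN : 1 ≤ N) {A : Set ℕ} {d : ℝ} (hd : 0 ≤ d)
    (hA : ∀ k ≤ N, unif N k A ≤ ENNReal.ofReal d) {p : ℝ≥0∞} (hp : p ≤ 1) :
    binMeasure N p A ≤ ENNReal.ofReal (22528 * d) := by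
  classical
  have h1 : p.toReal ≤ 1 := ENNReal.toReal_le_of_le_ofReal zero_le_one (by simpa using hp)
  have h0 : 0 ≤ p.toReal := ENNReal.toReal_nonneg
  have hex := fun k (hk : k ≤ N) => exists_Est_eq_gridpt hN hk
  choose! a ha1 ha _ hka _ using hex
  rw [binMeasure_apply hp]
  refine ENNReal.ofReal_le_ofReal ?_
  set S := (Finset.range (N + 1)).filter (· ∈ A)
  have hS : ∀ j ∈ S, j ≤ N ∧ j ∈ A := fun j hj => by
    obtain ⟨h2, h3⟩ := Finset.mem_filter.mp hj
    exact ⟨Nat.lt_succ_iff.mp (Finset.mem_range.mp h2), h3⟩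
  let L := S.sup a + 1
  have hmaps : ∀ j ∈ S, a j ∈ Finset.range L := fun j hj =>
    Finset.mem_range.mpr (Nat.lt_succ_of_le (Finset.le_sup hj))
  rw [← Finset.sum_fiberwise_of_maps_to hmaps]
  let w : ℕ → ℝ := fun b =>
    1 / ((1 + |(b : ℝ) - √N * angle p.toReal|) * (2 + |(b : ℝ) - √N * angle p.toReal|))
  have hw : ∀ b, 0 ≤ w b := fun b => by positivity
  have hfib : ∀ b ∈ Finset.range L,
      ∑ j ∈ S.filter (fun j => a j = b), binomialMass N p.toReal j ≤ 11264 * d * w b := by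
    intro b _
    rcases (S.filter fun j => a j = b).eq_empty_or_nonempty with he | ⟨k, hkS⟩
    · rw [he, Finset.sum_empty]
      exact mul_nonneg (by positivity) (hw b)
    obtain ⟨hkS, hkb⟩ := Finset.mem_filter.mp hkS
    obtain ⟨hkN, -⟩ := hS k hkS
    have hsub : S.filter (fun j => a j = b) ⊆ (cell N k).filter (· ∈ A) := fun j hj => by
      obtain ⟨hjS, hjb⟩ := Finset.mem_filter.mp hj
      obtain ⟨hjN, hjA⟩ := hS j hjS
      refine Finset.mem_filter.mpr ⟨mem_cell.mpr ⟨hjN, ?_⟩, hjA⟩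
      rw [hka j hjN, hka k hkN, hjb, hkb]
    have hc : (0 : ℝ) < (cell N k).card := by
      exact_mod_cast Finset.card_pos.mpr ⟨k, self_mem_cell hkN⟩
    have hcard := hA k hkN
    rw [unif_apply hkN, ENNReal.ofReal_le_ofReal_iff hd, div_le_iff₀ hc] at hcard
    calc _ ≤ ∑ j ∈ (cell N k).filter (· ∈ A), binomialMass N p.toReal j :=
          Finset.sum_le_sum_of_subset_of_nonneg hsub fun j _ _ => binomialMass_nonneg h0 h1 j
      _ ≤ ∑ j ∈ (cell N k).filter (· ∈ A), 11264 * w b / (cell N k).card := by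
          refine Finset.sum_le_sum fun j hj => ?_
          rw [le_div_iff₀ hc, mul_comm]
          have := card_cell_mul_binomialMass_le hN (ha1 k hkN) (ha k hkN) (hka k hkN)
            (Finset.mem_filter.mp hj).1 h0 h1
          rwa [hkb] at this
      _ = ((cell N k).filter (· ∈ A)).card * (11264 * w b / (cell N k).card) := by
          rw [Finset.sum_const, nsmul_eq_mul]
      _ ≤ (d * (cell N k).card) * (11264 * w b / (cell N k).card) := by
          have := hw b
          gcongr
      _ = _ := by field_simp
  calc _ ≤ ∑ b ∈ Finset.range L, 11264 * d * w b := Finset.sum_le_sum hfib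
    _ = 11264 * d * ∑ b ∈ Finset.range L, w b := by rw [Finset.mul_sum]
    _ ≤ 11264 * d * 2 := by
        gcongr
        exact sum_inv_shift_le _ _
    _ = _ := by ring

theorem ennreal_le_rpow_of_le_one {x : ℝ≥0∞} {z : ℝ} (hx : x ≤ 1) (hz : z ≤ 1) : x ≤ x ^ z := by
  simpa using ENNReal.rpow_le_rpow_of_exponent_ge hx hz

/-- there is a universal constant `c > 0` such that for every
`N ≥ 1` and every `κ ∈ (0, 0.9)`:
(a) for every p-function `f` w.r.t. the sin model (the uniform measures `U_k` on
the cells `𝔄(k)`, `k ∈ {0,…,N}`), `k ↦ min 1 (c·κ⁻¹·f(k)^{1-κ})` is a p-function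
w.r.t. the family of binomial measures;
(b) for every p-function `f` w.r.t. the family of binomial measures,
`k ↦ min 1 (κ⁻¹·(c·f(k))^{1-κ})` is a p-function w.r.t. the sin model. -/
theorem stmt18 :
    ∃ c : ℝ, 0 < c ∧ ∀ N : ℕ, 1 ≤ N → ∀ κ : ℝ, κ ∈ Set.Ioo (0 : ℝ) 0.9 →
      (∀ f : ℕ → ℝ≥0∞, (∀ k, f k ≤ 1) →
        (∀ k ≤ N, ∀ ε : ℝ≥0∞, 0 < ε → unif N k {j | f j ≤ ε} ≤ ε) →
        ∀ p : ℝ≥0∞, p ≤ 1 → ∀ ε : ℝ≥0∞, 0 < ε →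
          binMeasure N p
            {k | min 1 (ENNReal.ofReal c * (ENNReal.ofReal κ)⁻¹ * f k ^ (1 - κ)) ≤ ε}
            ≤ ε) ∧
      (∀ f : ℕ → ℝ≥0∞, (∀ k, f k ≤ 1) →
        (∀ p : ℝ≥0∞, p ≤ 1 → ∀ ε : ℝ≥0∞, 0 < ε →
          binMeasure N p {k | f k ≤ ε} ≤ ε) →
        ∀ k ≤ N, ∀ ε : ℝ≥0∞, 0 < ε →
          unif N k
            {j | min 1 ((ENNReal.ofReal κ)⁻¹ * (ENNReal.ofReal c * f j) ^ (1 - κ)) ≤ ε}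
            ≤ ε) := by
  have hc : (0 : ℝ) < 117 * Real.exp 400 + 22528 := by positivity
  refine ⟨117 * Real.exp 400 + 22528, hc, fun N hN κ hκ => ⟨fun f hf1 hf p hp ε hε => ?_,
    fun f hf1 hf k hk ε hε => ?_⟩⟩
  all_goals
    set c : ℝ := 117 * Real.exp 400 + 22528
    have hκ1 : 1 ≤ (ENNReal.ofReal κ)⁻¹ :=
      ENNReal.one_le_inv.mpr (ENNReal.ofReal_le_one.mpr (by linarith [hκ.2]))
    have hκ2 : 1 - κ ≤ 1 := by linarith [hκ.1]
    have hκ3 : 0 < 1 - κ := by linarith [hκ.2]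
    have hc0 : ENNReal.ofReal c ≠ 0 := by simpa using hc
    have hct : ENNReal.ofReal c ≠ ⊤ := ENNReal.ofReal_ne_top
  · rcases le_or_gt 1 ε with h1 | h1
    · exact (binMeasure_le_one hp _).trans h1
    have hεt : ε ≠ ⊤ := h1.ne_top
    have hsub : {k | min 1 (ENNReal.ofReal c * (ENNReal.ofReal κ)⁻¹ * f k ^ (1 - κ)) ≤ ε} ⊆
        {k | f k ≤ ε / ENNReal.ofReal c} := by
      intro k hk
      rcases min_le_iff.mp (Set.mem_ofPred_eq ▸ hk) with hk | hk
      · exact absurd hk (not_le.mpr h1)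
      rw [Set.mem_ofPred_eq, ENNReal.le_div_iff_mul_le (Or.inl hc0) (Or.inl hct)]
      calc f k * ENNReal.ofReal c ≤ f k ^ (1 - κ) * (ENNReal.ofReal c * (ENNReal.ofReal κ)⁻¹) := by
            gcongr
            · exact ennreal_le_rpow_of_le_one (hf1 k) hκ2
            · exact le_mul_of_one_le_right' hκ1
        _ ≤ ε := by rwa [mul_comm]
    have hε' : 0 < ε / ENNReal.ofReal c := ENNReal.div_pos hε.ne' hct
    have heq : ε / ENNReal.ofReal c = ENNReal.ofReal (ε.toReal / c) := by
      rw [ENNReal.ofReal_div_of_pos hc, ENNReal.ofReal_toReal hεt]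
    refine (measure_mono hsub).trans ?_
    refine (binMeasure_le_of_unif_le hN (d := ε.toReal / c) (by positivity)
      (fun k hk => heq ▸ hf k hk _ hε') hp).trans ?_
    rw [ENNReal.ofReal_le_iff_le_toReal hεt, mul_div_assoc', div_le_iff₀ hc, mul_comm]
    gcongr
    simp only [c]
    linarith [Real.exp_pos 400]
  · rcases le_or_gt 1 ε with h1 | h1
    · exact (unif_le_one hk _).trans h1
    have hsub : {j | min 1 ((ENNReal.ofReal κ)⁻¹ * (ENNReal.ofReal c * f j) ^ (1 - κ)) ≤ ε} ⊆
        {j | f j ≤ ε / ENNReal.ofReal c} := by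
      intro j hj
      rcases min_le_iff.mp (Set.mem_ofPred_eq ▸ hj) with hj | hj
      · exact absurd hj (not_le.mpr h1)
      have hle : (ENNReal.ofReal c * f j) ^ (1 - κ) ≤ ε := (le_mul_of_one_le_left' hκ1).trans hj
      have hlt : ENNReal.ofReal c * f j ≤ 1 := by
        by_contra! hgt
        exact absurd (ENNReal.one_lt_rpow hgt hκ3) (not_lt.mpr (hle.trans h1.le))
      rw [Set.mem_ofPred_eq, ENNReal.le_div_iff_mul_le (Or.inl hc0) (Or.inl hct), mul_comm]
      exact (ennreal_le_rpow_of_le_one hlt hκ2).trans hle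
    obtain ⟨p, hp, hdom⟩ := exists_unif_le_binMeasure hN hk
    have hε' : 0 < ε / ENNReal.ofReal c := ENNReal.div_pos hε.ne' hct
    calc _ ≤ unif N k {j | f j ≤ ε / ENNReal.ofReal c} := measure_mono hsub
      _ ≤ ENNReal.ofReal (117 * Real.exp 400) *
            binMeasure N p {j | f j ≤ ε / ENNReal.ofReal c} := hdom _
      _ ≤ ENNReal.ofReal c * (ε / ENNReal.ofReal c) := by
          gcongr
          · simp only [c]; linarith
          · exact hf p hp _ hε'
      _ = ε := ENNReal.mul_div_cancel hc0 hct
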